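/- Fix a positive integer r. For every real ε > 0 there exists a constant C = C(r, ε) such that for all sufficiently large integers K and Q with 1 ≤ K ≤ Q, (1/Q) · Σ_{Q ≤ q ≤ 2Q} J_r(q;K) ≤ C (K^{2r} Q^{-1} + K^r) Q^ε, where the sum is over integers q in [Q, 2Q]. -/

import Mathlib

open Finset

/-- `J_r(q;K)`: the number of `2r`-tuples `(x₁, …, x_{2r})` of integers with
`1 ≤ x₁, …, x_{2r} ≤ K`, each `xᵢ` coprime to `q`, satisfying
`x₁⁻¹ + ⋯ + x_r⁻¹ ≡ x_{r+1}⁻¹ + ⋯ + x_{2r}⁻¹ (mod q)`, where `x⁻¹` is the multiplicative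
inverse of `x` modulo `q`. The tuple is encoded as a pair of `r`-tuples. -/
noncomputable def reciprocalCongCount (r q K : ℕ) : ℕ :=
  Set.ncard {p : (Fin r → ℕ) × (Fin r → ℕ) |
    (∀ i, 1 ≤ p.1 i ∧ p.1 i ≤ K ∧ Nat.Coprime (p.1 i) q) ∧
    (∀ i, 1 ≤ p.2 i ∧ p.2 i ≤ K ∧ Nat.Coprime (p.2 i) q) ∧
    ∑ i, ((p.1 i : ZMod q))⁻¹ = ∑ i, ((p.2 i : ZMod q))⁻¹}

/-- The divisor bound `τ(n) ≪ n ^ δ`. -/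
theorem exists_card_divisors_le_rpow {δ : ℝ} (hδ : 0 < δ) :
    ∃ C : ℝ, 0 < C ∧ ∀ n : ℕ, n ≠ 0 → (#n.divisors : ℝ) ≤ C * (n : ℝ) ^ δ := by
  have hlog : 0 < Real.log 2 := Real.log_pos one_lt_two
  set B : ℝ := 1 + 1 / (δ * Real.log 2) with hB
  have hB1 : 1 ≤ B := le_add_of_nonneg_right (by positivity)
  set P : ℕ := ⌈(2 : ℝ) ^ (1 / δ)⌉₊ with hP
  refine ⟨B ^ P, by positivity, fun n hn => ?_⟩
  have hbound : ∀ p ∈ n.primeFactors, ((n.factorization p + 1 : ℕ) : ℝ) ≤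
      (if p < P then B else 1) * ((p : ℝ) ^ n.factorization p) ^ δ := by
    intro p hp
    have hp2 : (2 : ℝ) ≤ p := by exact_mod_cast (Nat.prime_of_mem_primeFactors hp).two_le
    set a := n.factorization p
    have hcomm : ((p : ℝ) ^ a) ^ δ = ((p : ℝ) ^ δ) ^ a := by
      rw [← Real.rpow_natCast, ← Real.rpow_natCast, ← Real.rpow_mul (by positivity),
        ← Real.rpow_mul (by positivity), mul_comm]
    split_ifs with h
    · have h1 : (1 : ℝ) + a * (δ * Real.log 2) ≤ ((p : ℝ) ^ a) ^ δ := by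
        calc (1 : ℝ) + a * (δ * Real.log 2) ≤ Real.exp (a * (δ * Real.log 2)) := by
              rw [add_comm]; exact Real.add_one_le_exp _
          _ = ((2 : ℝ) ^ δ) ^ a := by
              rw [Real.rpow_def_of_pos two_pos, ← Real.exp_nat_mul]; ring_nf
          _ ≤ ((p : ℝ) ^ δ) ^ a := by gcongr
          _ = _ := hcomm.symm
      calc ((a + 1 : ℕ) : ℝ) ≤ B * (1 + a * (δ * Real.log 2)) := by
            have h3 : B * (1 + a * (δ * Real.log 2)) =
                1 + a + a * (δ * Real.log 2) + 1 / (δ * Real.log 2) := by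
              rw [hB]; field_simp; ring
            have h4 : 0 ≤ a * (δ * Real.log 2) + 1 / (δ * Real.log 2) := by positivity
            rw [h3]; push_cast; linarith
        _ ≤ _ := by gcongr
    · have h1 : (2 : ℝ) ≤ (p : ℝ) ^ δ := by
        have h2 : (2 : ℝ) ^ (1 / δ) ≤ p :=
          (Nat.le_ceil _).trans (by exact_mod_cast not_lt.mp h)
        calc (2 : ℝ) = ((2 : ℝ) ^ (1 / δ)) ^ δ := by
              rw [← Real.rpow_mul two_pos.le, one_div_mul_cancel hδ.ne', Real.rpow_one]
          _ ≤ _ := by gcongr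
      rw [one_mul, hcomm]
      calc ((a + 1 : ℕ) : ℝ) ≤ (2 : ℝ) ^ a := by exact_mod_cast Nat.lt_two_pow_self
        _ ≤ _ := by gcongr
  have hprod : ∏ p ∈ n.primeFactors, ((p : ℝ) ^ n.factorization p) ^ δ = (n : ℝ) ^ δ := by
    rw [Real.finsetProd_rpow _ _ fun p _ => by positivity]
    congr 1
    conv_rhs => rw [← Nat.prod_factorization_pow_eq_self hn]
    simp [Finsupp.prod]
  calc (#n.divisors : ℝ) = ∏ p ∈ n.primeFactors, ((n.factorization p + 1 : ℕ) : ℝ) := by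
        rw [Nat.card_divisors hn]; push_cast; rfl
    _ ≤ ∏ p ∈ n.primeFactors,
          ((if p < P then B else 1) * ((p : ℝ) ^ n.factorization p) ^ δ) :=
        prod_le_prod (fun _ _ => by positivity) hbound
    _ = B ^ #{p ∈ n.primeFactors | p < P} * (n : ℝ) ^ δ := by
        rw [prod_mul_distrib, hprod, prod_ite, prod_const, prod_const_one, mul_one]
    _ ≤ B ^ P * (n : ℝ) ^ δ := by
        gcongr
        calc #{p ∈ n.primeFactors | p < P} ≤ #(range P) :=
              card_le_card fun p hp => by simpa using (mem_filter.mp hp).2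
          _ = P := card_range P

theorem Nat.factorization_finset_lcm {ι : Type*} (s : Finset ι) (x : ι → ℕ)
    (hx : ∀ i ∈ s, x i ≠ 0) (p : ℕ) :
    (s.lcm x).factorization p = s.sup fun i => (x i).factorization p := by
  classical
  induction s using Finset.induction_on with
  | empty => simp
  | insert a s ha ih =>
    have hs : s.lcm x ≠ 0 := by
      rw [Ne, Finset.lcm_eq_zero_iff]
      rintro ⟨i, hi, h⟩
      exact hx i (mem_insert_of_mem hi) h
    rw [lcm_insert, sup_insert, ← ih fun i hi => hx i (mem_insert_of_mem hi)]
    change (Nat.lcm _ _).factorization p = _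
    rw [Nat.factorization_lcm (hx a (mem_insert_self _ _)) hs]
    rfl

section Reciprocals

variable {ι : Type*} [Fintype ι] [DecidableEq ι]

/-- The numerator `∑ i, s i * ∏ j ≠ i, x j` of the signed sum `∑ i, s i / x i`. -/
def reciprocalNumerator (s : ι → ℤ) (x : ι → ℕ) : ℤ :=
  ∑ i, s i * ∏ j ∈ univ.erase i, (x j : ℤ)

theorem cast_reciprocalNumerator {R : Type*} [CommRing R] (s : ι → ℤ) (x : ι → ℕ) (z : ι → R)
    (hz : ∀ i, (x i : R) * z i = 1) :
    (reciprocalNumerator s x : R) = (∏ i, (x i : R)) * ∑ i, s i * z i := by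
  rw [reciprocalNumerator, mul_sum]
  push_cast
  refine sum_congr rfl fun i _ => ?_
  rw [← mul_prod_erase univ (fun j => (x j : R)) (mem_univ i)]
  linear_combination (-(s i : R) * ∏ j ∈ univ.erase i, (x j : R)) * hz i

theorem natAbs_reciprocalNumerator_le {s : ι → ℤ} (hs : ∀ i, |s i| = 1) {x : ι → ℕ} {K : ℕ}
    (hK : 1 ≤ K) (hx : ∀ i, x i ≤ K) :
    (reciprocalNumerator s x).natAbs ≤ Fintype.card ι * K ^ Fintype.card ι := by
  zify
  calc |reciprocalNumerator s x| ≤ ∑ i, |s i * ∏ j ∈ univ.erase i, (x j : ℤ)| :=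
        abs_sum_le_sum_abs _ _
    _ ≤ ∑ _i : ι, (K : ℤ) ^ Fintype.card ι := by
        refine sum_le_sum fun i _ => ?_
        rw [abs_mul, hs, one_mul, abs_prod]
        calc ∏ j ∈ univ.erase i, |(x j : ℤ)| ≤ ∏ _j ∈ univ.erase i, (K : ℤ) :=
              prod_le_prod (fun _ _ => abs_nonneg _) fun j _ => by simpa using hx j
          _ = (K : ℤ) ^ #(univ.erase i) := prod_const _
          _ ≤ _ := pow_le_pow_right₀ (by exact_mod_cast hK) (card_le_univ _)
    _ = _ := by simp

/-- If a signed sum of reciprocals vanishes, the square of the least common multiple of the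
denominators divides their product: every prime power exactly dividing the former divides at least
two of the denominators. -/
theorem lcm_sq_dvd_prod_of_reciprocalNumerator_eq_zero {s : ι → ℤ} (hs : ∀ i, |s i| = 1)
    {x : ι → ℕ} (hx : ∀ i, x i ≠ 0) (h : reciprocalNumerator s x = 0) :
    univ.lcm x ^ 2 ∣ ∏ i, x i := by
  have hprod : ∏ i, x i ≠ 0 := prod_ne_zero_iff.mpr fun i _ => hx i
  have hlcm : univ.lcm x ≠ 0 := by
    rw [Ne, Finset.lcm_eq_zero_iff]
    rintro ⟨i, -, hi⟩
    exact hx i hi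
  rw [← Nat.factorization_prime_le_iff_dvd (pow_ne_zero _ hlcm) hprod]
  intro p hp
  have : Fact p.Prime := ⟨hp⟩
  rw [Nat.factorization_pow, Finsupp.smul_apply, smul_eq_mul,
    Nat.factorization_finset_lcm _ _ fun i _ => hx i,
    Nat.factorization_prod fun i _ => hx i, Finsupp.finsetSum_apply]
  set v : ι → ℕ := fun i => (x i).factorization p with hv
  rcases isEmpty_or_nonempty ι with hι | hι
  · simp
  obtain ⟨i, -, hi⟩ := exists_mem_eq_sup univ univ_nonempty v
  rw [hi]
  rcases Nat.eq_zero_or_pos (v i) with h0 | hpos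
  · simp [h0]
  have hsum : ∑ j, (s j : ℚ) * (x j : ℚ)⁻¹ = 0 := by
    have := cast_reciprocalNumerator (R := ℚ) s x (fun j => (x j : ℚ)⁻¹)
      fun j => mul_inv_cancel₀ (by exact_mod_cast hx j)
    rw [h, Int.cast_zero, eq_comm, mul_eq_zero] at this
    exact this.resolve_left (by exact_mod_cast hprod)
  have hnorm : ∀ j, padicNorm p ((s j : ℚ) * (x j : ℚ)⁻¹) = (p : ℚ) ^ v j := by
    intro j
    have hsj : padicNorm p (s j : ℚ) = 1 := by
      rcases (abs_eq zero_le_one).mp (hs j) with h | h <;> simp [h]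
    rw [padicNorm.mul, hsj, one_mul, padicNorm.eq_zpow_of_nonzero
      (inv_ne_zero (by exact_mod_cast hx j)), padicValRat.inv, padicValRat.of_nat, neg_neg,
      zpow_natCast, hv]
    simp only [Nat.factorization_def _ hp]
  have hp1 : (1 : ℚ) < p := by exact_mod_cast hp.one_lt
  obtain ⟨j, hji, hj⟩ : ∃ j, j ≠ i ∧ v i ≤ v j := by
    by_contra! hlt
    have h1 : padicNorm p (∑ j ∈ univ.erase i, (s j : ℚ) * (x j : ℚ)⁻¹) < (p : ℚ) ^ v i := by
      refine padicNorm.sum_lt' (fun j hj => ?_) (by positivity)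
      rw [hnorm]
      exact pow_lt_pow_right₀ hp1 (hlt j (ne_of_mem_erase hj))
    rw [← add_sum_erase _ _ (mem_univ i)] at hsum
    rw [eq_neg_of_add_eq_zero_right hsum, padicNorm.neg, hnorm] at h1
    exact lt_irrefl _ h1
  calc 2 * v i ≤ v i + v j := by omega
    _ = ∑ k ∈ {i, j}, v k := (sum_pair hji.symm).symm
    _ ≤ ∑ k, v k := sum_le_sum_of_subset (subset_univ _)

/-- The number of vanishing signed sums of `2r` reciprocals of integers up to `K`. -/
theorem card_reciprocalNumerator_eq_zero_le {s : ι → ℤ} (hs : ∀ i, |s i| = 1) {r : ℕ}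
    (hr : Fintype.card ι = 2 * r) (K : ℕ) {D : ℝ}
    (hD : ∀ n : ℕ, n ≠ 0 → n ≤ K ^ r → (#n.divisors : ℝ) ≤ D) :
    (#{x ∈ Fintype.piFinset fun _ : ι => Icc 1 K | reciprocalNumerator s x = 0} : ℝ) ≤
      (K : ℝ) ^ r * D ^ (2 * r) := by
  have hsub : {x ∈ Fintype.piFinset fun _ : ι => Icc 1 K | reciprocalNumerator s x = 0} ⊆
      (Icc 1 (K ^ r)).biUnion fun L => Fintype.piFinset fun _ : ι => L.divisors := by
    intro x hx
    simp only [mem_filter, Fintype.mem_piFinset, mem_Icc] at hx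
    have hx0 : ∀ i, x i ≠ 0 := fun i => by have := hx.1 i; omega
    have hlcm : univ.lcm x ≠ 0 := by
      rw [Ne, Finset.lcm_eq_zero_iff]
      rintro ⟨i, -, hi⟩
      exact hx0 i hi
    simp only [mem_biUnion, mem_Icc, Fintype.mem_piFinset, Nat.mem_divisors]
    refine ⟨univ.lcm x, ⟨Nat.one_le_iff_ne_zero.mpr hlcm, ?_⟩,
      fun i => ⟨dvd_lcm (mem_univ i), hlcm⟩⟩
    refine (Nat.pow_le_pow_iff_left two_ne_zero).mp ?_
    calc univ.lcm x ^ 2 ≤ ∏ i, x i :=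
          Nat.le_of_dvd (Nat.pos_of_ne_zero (prod_ne_zero_iff.mpr fun i _ => hx0 i))
            (lcm_sq_dvd_prod_of_reciprocalNumerator_eq_zero hs hx0 hx.2)
      _ ≤ ∏ _i : ι, K := prod_le_prod' fun i _ => (hx.1 i).2
      _ = (K ^ r) ^ 2 := by rw [prod_const, card_univ, hr, mul_comm, pow_mul]
  calc (#{x ∈ Fintype.piFinset fun _ : ι => Icc 1 K | reciprocalNumerator s x = 0} : ℝ)
      ≤ ∑ L ∈ Icc 1 (K ^ r), (#L.divisors : ℝ) ^ (2 * r) := by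
        have := (card_le_card hsub).trans card_biUnion_le
        simp only [Fintype.card_piFinset, prod_const, card_univ, hr] at this
        exact_mod_cast this
    _ ≤ ∑ _L ∈ Icc 1 (K ^ r), D ^ (2 * r) := by
        refine sum_le_sum fun L hL => ?_
        rw [mem_Icc] at hL
        exact pow_le_pow_left₀ (by positivity) (hD L (by omega) hL.2) _
    _ = _ := by simp

end Reciprocals

theorem reciprocalCongCount_le (r q K : ℕ) :
    reciprocalCongCount r q K ≤ #{x ∈ Fintype.piFinset fun _ : Fin r ⊕ Fin r => Icc 1 K |
      (q : ℤ) ∣ reciprocalNumerator (Sum.elim 1 (-1)) x} := by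
  rw [reciprocalCongCount, ← Set.ncard_coe_finset]
  refine Set.ncard_le_ncard_of_injOn (fun p => Sum.elim p.1 p.2) ?_ ?_ (finite_toSet _)
  · rintro ⟨x, y⟩ ⟨hx, hy, h⟩
    simp only [coe_filter, Fintype.mem_piFinset, mem_Icc, Set.mem_ofPred_eq]
    refine ⟨Sum.rec (fun i => ⟨(hx i).1, (hx i).2.1⟩) fun i => ⟨(hy i).1, (hy i).2.1⟩, ?_⟩
    rw [← ZMod.intCast_zmod_eq_zero_iff_dvd,
      cast_reciprocalNumerator _ _ fun i => ((Sum.elim x y i : ℕ) : ZMod q)⁻¹]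
    · simp only [Fintype.sum_sum_type, Sum.elim_inl, Sum.elim_inr]
      simp_all
    · exact Sum.rec (fun i => ZMod.coe_mul_inv_eq_one _ (hx i).2.2)
        fun i => ZMod.coe_mul_inv_eq_one _ (hy i).2.2
  · rintro ⟨x, y⟩ - ⟨x', y'⟩ - h
    have h1 : x = x' := funext fun i => congrFun h (Sum.inl i)
    have h2 : y = y' := funext fun i => congrFun h (Sum.inr i)
    rw [h1, h2]

theorem sum_reciprocalCongCount_le (r K Q : ℕ) (hK : 1 ≤ K) {D E : ℝ} (hQ : 1 ≤ Q)
    (hD : ∀ n : ℕ, n ≠ 0 → n ≤ K ^ r → (#n.divisors : ℝ) ≤ D)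
    (hE : ∀ n : ℕ, n ≠ 0 → n ≤ 2 * r * K ^ (2 * r) → (#n.divisors : ℝ) ≤ E) (hE0 : 0 ≤ E) :
    ∑ q ∈ Icc Q (2 * Q), (reciprocalCongCount r q K : ℝ) ≤
      (K : ℝ) ^ (2 * r) * E + 2 * Q * ((K : ℝ) ^ r * D ^ (2 * r)) := by
  set s : Fin r ⊕ Fin r → ℤ := Sum.elim 1 (-1)
  have hs : ∀ i, |s i| = 1 := Sum.rec (fun _ => by simp [s]) fun _ => by simp [s]
  have hcard : Fintype.card (Fin r ⊕ Fin r) = 2 * r := by simp [two_mul]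
  set T := Fintype.piFinset fun _ : Fin r ⊕ Fin r => Icc 1 K with hT
  have hpt : ∀ x ∈ T, (#{q ∈ Icc Q (2 * Q) | ((q : ℕ) : ℤ) ∣ reciprocalNumerator s x} : ℝ) ≤
      E + if reciprocalNumerator s x = 0 then (2 * Q : ℝ) else 0 := by
    intro x hx
    simp only [hT, Fintype.mem_piFinset, mem_Icc] at hx
    split_ifs with h
    · have h1 : #{q ∈ Icc Q (2 * Q) | ((q : ℕ) : ℤ) ∣ reciprocalNumerator s x} ≤ 2 * Q :=
        (card_filter_le _ _).trans (by rw [Nat.card_Icc]; omega)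
      have h2 : (#{q ∈ Icc Q (2 * Q) | ((q : ℕ) : ℤ) ∣ reciprocalNumerator s x} : ℝ) ≤ 2 * Q := by
        exact_mod_cast h1
      linarith
    · rw [add_zero]
      have h0 : (reciprocalNumerator s x).natAbs ≠ 0 := Int.natAbs_ne_zero.mpr h
      refine le_trans ?_ (hE _ h0 ?_)
      · refine Nat.cast_le.mpr (card_le_card fun q hq => ?_)
        exact Nat.mem_divisors.mpr ⟨Int.natCast_dvd.mp (mem_filter.mp hq).2, h0⟩
      · have := natAbs_reciprocalNumerator_le hs hK fun i => (hx i).2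
        rwa [hcard] at this
  calc ∑ q ∈ Icc Q (2 * Q), (reciprocalCongCount r q K : ℝ)
      ≤ ∑ q ∈ Icc Q (2 * Q), (#{x ∈ T | (q : ℤ) ∣ reciprocalNumerator s x} : ℝ) :=
        sum_le_sum fun q _ => by exact_mod_cast reciprocalCongCount_le r q K
    _ = ∑ x ∈ T, (#{q ∈ Icc Q (2 * Q) | ((q : ℕ) : ℤ) ∣ reciprocalNumerator s x} : ℝ) := by
        exact_mod_cast sum_card_bipartiteAbove_eq_sum_card_bipartiteBelow
          (s := Icc Q (2 * Q)) (t := T) fun (q : ℕ) x => (q : ℤ) ∣ reciprocalNumerator s x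
    _ ≤ ∑ x ∈ T, (E + if reciprocalNumerator s x = 0 then (2 * Q : ℝ) else 0) :=
        sum_le_sum hpt
    _ = (K : ℝ) ^ (2 * r) * E + 2 * Q * #{x ∈ T | reciprocalNumerator s x = 0} := by
        rw [sum_add_distrib, ← sum_filter, sum_const, sum_const, hT, Fintype.card_piFinset,
          prod_const, card_univ, hcard, Nat.card_Icc, Nat.add_sub_cancel]
        simp only [nsmul_eq_mul]
        push_cast
        ring
    _ ≤ _ := by
        gcongr
        exact card_reciprocalNumerator_eq_zero_le hs hcard K hD

/-- Lemma (average of `J_r(q;K)` over `q ∈ [Q, 2Q]`): fix a positive integer `r`. For every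
`ε > 0` there is a constant `C = C(r, ε)` such that for all sufficiently large integers
`1 ≤ K ≤ Q`, `(1/Q) ∑_{Q ≤ q ≤ 2Q} J_r(q;K) ≤ C (K^{2r} Q^{-1} + K^r) Q^ε`. -/
theorem reciprocal_congruence_count_average_bound (r : ℕ) (hr : 1 ≤ r) (ε : ℝ) (hε : 0 < ε) :
    ∃ C : ℝ, ∃ n₀ : ℕ, 1 ≤ n₀ ∧ ∀ K Q : ℕ, n₀ ≤ K → K ≤ Q →
      (1 / (Q : ℝ)) * ∑ q ∈ Finset.Icc Q (2 * Q), (reciprocalCongCount r q K : ℝ) ≤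
        C * ((K : ℝ) ^ (2 * r) * (Q : ℝ)⁻¹ + (K : ℝ) ^ r) * (Q : ℝ) ^ ε := by
  have hr0 : (0 : ℝ) < r := by exact_mod_cast hr
  set δ : ℝ := ε / (2 * r) with hδ
  set η : ℝ := ε / (2 * r * r) with hη
  obtain ⟨A, hA, hAb⟩ := exists_card_divisors_le_rpow (δ := δ) (by positivity)
  obtain ⟨B, hB, hBb⟩ := exists_card_divisors_le_rpow (δ := η) (by positivity)
  refine ⟨A * (2 * r) ^ δ + 2 * B ^ (2 * r), 1, le_rfl, fun K Q hK hKQ => ?_⟩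
  have hQ : 1 ≤ Q := hK.trans hKQ
  have hQ0 : (0 : ℝ) < Q := by exact_mod_cast hQ
  have hKQ' : (K : ℝ) ≤ Q := by exact_mod_cast hKQ
  have hpow (k : ℕ) (θ : ℝ) : ((Q : ℝ) ^ k) ^ θ = (Q : ℝ) ^ (k * θ) := by
    rw [← Real.rpow_natCast, ← Real.rpow_mul hQ0.le]
  have hD : ∀ n : ℕ, n ≠ 0 → n ≤ K ^ r → (#n.divisors : ℝ) ≤ B * (Q : ℝ) ^ (r * η) := by
    intro n hn hle
    have h1 : (n : ℝ) ≤ (Q : ℝ) ^ r := by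
      calc (n : ℝ) ≤ (K : ℝ) ^ r := by exact_mod_cast hle
        _ ≤ _ := by gcongr
    rw [← hpow]
    exact (hBb n hn).trans (by gcongr)
  have hE : ∀ n : ℕ, n ≠ 0 → n ≤ 2 * r * K ^ (2 * r) →
      (#n.divisors : ℝ) ≤ A * (2 * r) ^ δ * (Q : ℝ) ^ ε := by
    intro n hn hle
    have h1 : (n : ℝ) ≤ 2 * r * (Q : ℝ) ^ (2 * r) := by
      calc (n : ℝ) ≤ 2 * r * (K : ℝ) ^ (2 * r) := by exact_mod_cast hle
        _ ≤ _ := by gcongr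
    have h2 : (2 * r * (Q : ℝ) ^ (2 * r)) ^ δ = (2 * r) ^ δ * (Q : ℝ) ^ ε := by
      rw [Real.mul_rpow (by positivity) (by positivity), hpow, hδ]
      congr 2
      push_cast
      field_simp
    rw [mul_assoc, ← h2]
    exact (hAb n hn).trans (by gcongr)
  have hDpow : (B * (Q : ℝ) ^ (r * η)) ^ (2 * r) = B ^ (2 * r) * (Q : ℝ) ^ ε := by
    rw [mul_pow, ← Real.rpow_natCast ((Q : ℝ) ^ (r * η)), ← Real.rpow_mul hQ0.le, hη]
    congr 2
    push_cast
    field_simp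
  have hmain := sum_reciprocalCongCount_le r K Q hK hQ hD hE (by positivity)
  rw [hDpow] at hmain
  set a : ℝ := A * (2 * r) ^ δ
  set b : ℝ := B ^ (2 * r)
  calc _ ≤ (1 / (Q : ℝ)) * ((K : ℝ) ^ (2 * r) * (a * (Q : ℝ) ^ ε) +
        2 * Q * ((K : ℝ) ^ r * (b * (Q : ℝ) ^ ε))) := by gcongr
    _ = (a * ((K : ℝ) ^ (2 * r) * (Q : ℝ)⁻¹) + 2 * b * (K : ℝ) ^ r) * (Q : ℝ) ^ ε := by
        field_simp
    _ ≤ _ := by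
        gcongr
        have h1 : 0 ≤ a * (K : ℝ) ^ r := by positivity
        have h2 : 0 ≤ 2 * b * ((K : ℝ) ^ (2 * r) * (Q : ℝ)⁻¹) := by positivity
        linarith
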